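/- For every t ≥ 0 and r > 0 there exists a constant C(t,r) > 0 such that for all x, y ∈ ℝ² with |x| ≥ r and |y| ≥ r: C(t,r)·min(|x−y|, |x+y|) ≤ W_c(μ_x^t, μ_y^t). -/

import Mathlib

open MeasureTheory ENNReal

/-- A coupling of two measures: a measure on the product whose marginals are the two
given measures. -/
def IsCoupling {Y : Type*} [MeasurableSpace Y] (π : Measure (Y × Y)) (μ ν : Measure Y) : Prop :=
  π.map Prod.fst = μ ∧ π.map Prod.snd = ν

/-- The (squared) optimal transport cost for the quadratic cost built from `c`. -/
noncomputable def transportCost {Y : Type*} [MeasurableSpace Y] (c : Y → Y → ℝ)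
    (μ ν : Measure Y) : ℝ≥0∞ :=
  ⨅ (π : Measure (Y × Y)) (_ : IsCoupling π μ ν), ∫⁻ p, ENNReal.ofReal (c p.1 p.2 ^ 2) ∂π

/-- The `L²`-Wasserstein distance associated to the cost `c`. -/
noncomputable def W2 {Y : Type*} [MeasurableSpace Y] (c : Y → Y → ℝ) (μ ν : Measure Y) : ℝ :=
  Real.sqrt (transportCost c μ ν).toReal

/-- A measure on a metric space has finite second moment. -/
def HasFiniteSecondMoment {X : Type*} [MetricSpace X] [MeasurableSpace X] (μ : Measure X) :
    Prop :=
  ∃ x₀ : X, ∫⁻ x, ENNReal.ofReal (dist x₀ x ^ 2) ∂μ < ⊤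

/-- A partition `0 = s 0 < s 1 < ⋯ < s N = 1` of `[0,1]`. -/
def IsPartition (N : ℕ) (s : ℕ → ℝ) : Prop :=
  s 0 = 0 ∧ s N = 1 ∧ ∀ i < N, s i < s (i + 1)

/-- The length of the curve `γ : [0,1] → Y` with respect to the distance `ρ`, as the
supremum over partitions of sums of consecutive `ρ`-distances. -/
noncomputable def curveLength {Y : Type*} (ρ : Y → Y → ℝ) (γ : ℝ → Y) : ℝ≥0∞ :=
  ⨆ (N : ℕ) (s : ℕ → ℝ) (_ : IsPartition N s),
    ENNReal.ofReal (∑ i ∈ Finset.range N, ρ (γ (s i)) (γ (s (i + 1))))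

/-- Continuity of a curve `γ : [0,1] → Y` with respect to the distance `ρ`. -/
def RhoContinuousCurve {Y : Type*} (ρ : Y → Y → ℝ) (γ : ℝ → Y) : Prop :=
  ∀ s ∈ Set.Icc (0:ℝ) 1, ∀ ε > 0, ∃ δ > 0, ∀ s' ∈ Set.Icc (0:ℝ) 1,
    |s' - s| < δ → ρ (γ s) (γ s') < ε

/-- The length distance induced by the distance `ρ`. -/
noncomputable def lengthDist {Y : Type*} (ρ : Y → Y → ℝ) (x y : Y) : ℝ≥0∞ :=
  ⨅ (γ : ℝ → Y) (_ : RhoContinuousCurve ρ γ ∧ γ 0 = x ∧ γ 1 = y), curveLength ρ γ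

/-- A metric space is a length space: the distance coincides with the induced length
distance. -/
def IsLengthSpace (X : Type*) [MetricSpace X] : Prop :=
  ∀ x y : X, lengthDist (fun a b => dist a b) x y = ENNReal.ofReal (dist x y)

/-- The Gaussian measure on `ℝ²` centered at `x` with variance `2t` (heat kernel at
time `t`). -/
noncomputable def gauss2 (t : ℝ) (x : EuclideanSpace ℝ (Fin 2)) :
    Measure (EuclideanSpace ℝ (Fin 2)) :=
  volume.withDensity fun y =>
    ENNReal.ofReal ((4 * Real.pi * t)⁻¹ * Real.exp (-‖y - x‖ ^ 2 / (4 * t)))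

/-- The symmetric lift `μ_x^t = ½(γ_x^t + γ_{-x}^t)` of the heat kernel measure on the
cone `C(π)` centered at the class of `x` (with `μ_x^0 = ½(δ_x + δ_{-x})`). -/
noncomputable def symGauss (t : ℝ) (x : EuclideanSpace ℝ (Fin 2)) :
    Measure (EuclideanSpace ℝ (Fin 2)) :=
  if t = 0 then (2 : ℝ≥0∞)⁻¹ • (Measure.dirac x + Measure.dirac (-x))
  else (2 : ℝ≥0∞)⁻¹ • (gauss2 t x + gauss2 t (-x))

/-- The cone cost on `ℝ²`: the lift of the cone distance of `C(π)`. -/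
noncomputable def coneCost (x y : EuclideanSpace ℝ (Fin 2)) : ℝ :=
  min ‖x - y‖ ‖x + y‖

section SymmetrizedTranslate

local notation "E" => EuclideanSpace ℝ (Fin 2)

/-- The symmetrized translate `½((x + ·)_* γ + (-x + ·)_* γ)` of a measure `γ`. -/
noncomputable def symTranslate (γ : Measure E) (x : E) : Measure E :=
  (2 : ℝ≥0∞)⁻¹ • (γ.map (x + ·) + γ.map (-x + ·))

lemma symTranslate_neg (γ : Measure E) (x : E) : symTranslate γ (-x) = symTranslate γ x := by
  simp [symTranslate, add_comm]

lemma coneCost_nonneg (x y : E) : 0 ≤ coneCost x y :=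
  le_min (norm_nonneg _) (norm_nonneg _)

lemma coneCost_comm (x y : E) : coneCost x y = coneCost y x := by
  simp [coneCost, norm_sub_rev x y, add_comm x y]

lemma measurable_coneCost : Measurable fun p : E × E => coneCost p.1 p.2 := by
  unfold coneCost; fun_prop

lemma transportCost_coneCost_comm (μ ν : Measure E) :
    transportCost coneCost μ ν = transportCost coneCost ν μ := by
  have key : ∀ μ ν : Measure E, transportCost coneCost μ ν ≤ transportCost coneCost ν μ := by
    intro μ ν
    refine le_iInf₂ fun π hπ => ?_
    refine iInf₂_le_of_le (π.map Prod.swap) ⟨?_, ?_⟩ ?_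
    · rw [Measure.map_map measurable_fst measurable_swap]; exact hπ.2
    · rw [Measure.map_map measurable_snd measurable_swap]; exact hπ.1
    · rw [lintegral_map (by have := measurable_coneCost; fun_prop) measurable_swap]
      simp [coneCost_comm]
  exact le_antisymm (key _ _) (key _ _)

lemma abs_inner_le_add_coneCost (u v w : E) :
    |inner ℝ u w| ≤ |inner ℝ v w| + ‖w‖ * coneCost u v := by
  have h1 := abs_real_inner_le_norm (u - v) w
  have h2 := abs_real_inner_le_norm (u + v) w
  rw [inner_sub_left] at h1
  rw [inner_add_left] at h2
  have h3 : |inner ℝ u w| - |inner ℝ v w| ≤ |inner ℝ u w - inner ℝ v w| :=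
    abs_sub_abs_le_abs_sub _ _
  have h4 : |inner ℝ u w| - |inner ℝ v w| ≤ |inner ℝ u w + inner ℝ v w| := by
    simpa using abs_sub_abs_le_abs_sub (inner ℝ u w) (-inner ℝ v w)
  unfold coneCost
  rcases min_choice ‖u - v‖ ‖u + v‖ with h | h <;> rw [h] <;> nlinarith

lemma abs_add_add_abs_neg_add (a s : ℝ) : |a + s| + |-a + s| = 2 * max |a| |s| := by
  grind [abs_cases]

lemma lintegral_abs_inner_symTranslate (γ : Measure E) (x w : E) :
    ∫⁻ u, ENNReal.ofReal |inner ℝ u w| ∂(symTranslate γ x) =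
      ∫⁻ z, ENNReal.ofReal (max |inner ℝ x w| |inner ℝ z w|) ∂γ := by
  rw [symTranslate, lintegral_smul_measure, lintegral_add_measure,
    lintegral_map (by fun_prop) (by fun_prop), lintegral_map (by fun_prop) (by fun_prop),
    ← lintegral_add_left (by fun_prop), smul_eq_mul, ← lintegral_const_mul _ (by fun_prop)]
  refine lintegral_congr fun z => ?_
  rw [← ENNReal.ofReal_add (abs_nonneg _) (abs_nonneg _), inner_add_left, inner_add_left,
    inner_neg_left, abs_add_add_abs_neg_add, ENNReal.ofReal_mul two_pos.le, ← mul_assoc,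
    ENNReal.ofReal_ofNat, ENNReal.inv_mul_cancel two_ne_zero ofNat_ne_top, one_mul]

/-- A direction in which both `x` and `y` are uniformly away from `0` and uniformly
separated from each other. -/
lemma exists_separating_direction {x y : E} (hxy : x ≠ y) (hy : y ≠ 0)
    (hle : ‖y‖ ≤ ‖x‖) (hinner : 0 ≤ inner ℝ x y) :
    ∃ w : E, ‖w‖ ≤ 2 ∧ ‖y‖ / 4 ≤ inner ℝ y w ∧ ‖x - y‖ / 4 ≤ inner ℝ (x - y) w := by
  have hD : 0 < ‖x - y‖ := norm_pos_iff.2 (sub_ne_zero.2 hxy)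
  have hY : 0 < ‖y‖ := norm_pos_iff.2 hy
  have hs : -(3 / 4 * (‖x - y‖ * ‖y‖)) ≤ inner ℝ (x - y) y := by
    have e1 : inner ℝ (x - y) y = inner ℝ x y - ‖y‖ ^ 2 := by
      rw [inner_sub_left, real_inner_self_eq_norm_sq]
    have e2 := norm_sub_sq_real x y
    by_contra! h
    set s := inner ℝ (x - y) y
    have h1 : 0 < -s := by nlinarith [mul_pos hD hY]
    have h2 : -s ≤ ‖x - y‖ ^ 2 / 2 := by nlinarith
    have h3 : -s ≤ ‖y‖ ^ 2 := by linarith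
    have h4 : (-s) * (-s) ≤ ‖x - y‖ ^ 2 / 2 * ‖y‖ ^ 2 :=
      mul_le_mul h2 h3 h1.le (by positivity)
    nlinarith [mul_pos hD hY]
  refine ⟨‖x - y‖⁻¹ • (x - y) + ‖y‖⁻¹ • y, ?_, ?_, ?_⟩
  · refine (norm_add_le _ _).trans ?_
    rw [norm_smul, norm_smul, norm_inv, norm_inv, norm_norm, norm_norm,
      inv_mul_cancel₀ hD.ne', inv_mul_cancel₀ hY.ne']
    norm_num
  · rw [inner_add_right, inner_smul_right, inner_smul_right, real_inner_self_eq_norm_sq,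
      real_inner_comm]
    have h1 : ‖y‖⁻¹ * ‖y‖ ^ 2 = ‖y‖ := by field_simp
    have h2 := mul_le_mul_of_nonneg_left hs (inv_nonneg.2 hD.le)
    have h3 : ‖x - y‖⁻¹ * -(3 / 4 * (‖x - y‖ * ‖y‖)) = -(3 / 4 * ‖y‖) := by field_simp
    linarith
  · rw [inner_add_right, inner_smul_right, inner_smul_right, real_inner_self_eq_norm_sq]
    have h1 : ‖x - y‖⁻¹ * ‖x - y‖ ^ 2 = ‖x - y‖ := by field_simp
    have h2 := mul_le_mul_of_nonneg_left hs (inv_nonneg.2 hY.le)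
    have h3 : ‖y‖⁻¹ * -(3 / 4 * (‖x - y‖ * ‖y‖)) = -(3 / 4 * ‖x - y‖) := by field_simp
    linarith

lemma sq_le_lintegral_sq {Ω : Type*} [MeasurableSpace Ω] {P : Measure Ω} [IsProbabilityMeasure P]
    {c : Ω → ℝ} (hc : Measurable c) {M : ℝ} (hM : 0 ≤ M)
    (h : ENNReal.ofReal M ≤ ∫⁻ p, ENNReal.ofReal (c p) ∂P) :
    ENNReal.ofReal (M ^ 2) ≤ ∫⁻ p, ENNReal.ofReal (c p ^ 2) ∂P := by
  have h1 : ENNReal.ofReal (2 * M) * ENNReal.ofReal M ≤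
      ∫⁻ p, ENNReal.ofReal (c p ^ 2) ∂P + ENNReal.ofReal (M ^ 2) := by
    calc _ ≤ ENNReal.ofReal (2 * M) * ∫⁻ p, ENNReal.ofReal (c p) ∂P := by gcongr
      _ = ∫⁻ p, ENNReal.ofReal (2 * M * c p) ∂P := by
        rw [← lintegral_const_mul _ (by fun_prop)]
        simp_rw [ENNReal.ofReal_mul (by positivity : 0 ≤ 2 * M)]
      _ ≤ ∫⁻ p, (ENNReal.ofReal (c p ^ 2) + ENNReal.ofReal (M ^ 2)) ∂P := by
        refine lintegral_mono fun p => ?_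
        rw [← ENNReal.ofReal_add (by positivity) (by positivity)]
        exact ENNReal.ofReal_le_ofReal (by nlinarith [sq_nonneg (c p - M)])
      _ = _ := by rw [lintegral_add_right _ measurable_const]; simp
  rw [← ENNReal.ofReal_mul (by positivity), show 2 * M * M = M ^ 2 + M ^ 2 by ring,
    ENNReal.ofReal_add (by positivity) (by positivity)] at h1
  exact (ENNReal.add_le_add_iff_right ENNReal.ofReal_ne_top).1 h1

lemma add_le_lintegral_max {γ : Measure E} [IsProbabilityMeasure γ] {ρ : ℝ} {w : E}
    (hw : ‖w‖ ≤ 2) {a b : ℝ} (hab : b ≤ a) (hb : 2 * ρ ≤ b) (hρ : 0 ≤ ρ) :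
    ∫⁻ z, ENNReal.ofReal (max |b| |inner ℝ z w|) ∂γ +
        ENNReal.ofReal (γ.real (Metric.closedBall 0 ρ) * (a - b)) ≤
      ∫⁻ z, ENNReal.ofReal (max |a| |inner ℝ z w|) ∂γ := by
  have e : ENNReal.ofReal (γ.real (Metric.closedBall 0 ρ) * (a - b)) =
      ∫⁻ z, (Metric.closedBall (0 : E) ρ).indicator (fun _ => ENNReal.ofReal (a - b)) z ∂γ := by
    rw [lintegral_indicator_const Metric.isClosed_closedBall.measurableSet, mul_comm,
      ENNReal.ofReal_mul (by linarith), ofReal_measureReal]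
  rw [e, ← lintegral_add_left (by fun_prop)]
  refine lintegral_mono fun z => ?_
  rw [abs_of_nonneg (by linarith : 0 ≤ b), abs_of_nonneg (by linarith : 0 ≤ a)]
  by_cases hz : z ∈ Metric.closedBall (0 : E) ρ
  · have hz' : |inner ℝ z w| ≤ b := by
      have := abs_real_inner_le_norm z w
      rw [mem_closedBall_zero_iff] at hz
      nlinarith [norm_nonneg z, norm_nonneg w]
    simp only [Set.indicator_of_mem hz]
    rw [max_eq_left hz', max_eq_left (hz'.trans hab),
      ← ENNReal.ofReal_add (by linarith) (by linarith)]
    simp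
  · simp only [Set.indicator_of_notMem hz, add_zero]
    gcongr

lemma transportCost_symTranslate_lt_top (γ : Measure E) [IsFiniteMeasure γ] (x y : E) :
    transportCost coneCost (symTranslate γ x) (symTranslate γ y) < ⊤ := by
  let π : Measure (E × E) := (2 : ℝ≥0∞)⁻¹ •
    (γ.map (fun z => (x + z, y + z)) + γ.map (fun z => (-x + z, -y + z)))
  have hπ : IsCoupling π (symTranslate γ x) (symTranslate γ y) := by
    constructor
    · rw [Measure.map_smul, Measure.map_add _ _ measurable_fst,
        Measure.map_map measurable_fst (by fun_prop),
        Measure.map_map measurable_fst (by fun_prop)]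
      rfl
    · rw [Measure.map_smul, Measure.map_add _ _ measurable_snd,
        Measure.map_map measurable_snd (by fun_prop),
        Measure.map_map measurable_snd (by fun_prop)]
      rfl
  refine (iInf₂_le π hπ).trans_lt ?_
  have hm : Measurable fun p : E × E => ENNReal.ofReal (coneCost p.1 p.2 ^ 2) := by
    have := measurable_coneCost
    fun_prop
  rw [lintegral_smul_measure, lintegral_add_measure, lintegral_map hm (by fun_prop),
    lintegral_map hm (by fun_prop), smul_eq_mul]
  have bound : ∀ u v : E, coneCost u v ^ 2 ≤ ‖u - v‖ ^ 2 := fun u v =>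
    pow_le_pow_left₀ (coneCost_nonneg u v) (min_le_left _ _) 2
  refine ENNReal.mul_lt_top (by simp) (ENNReal.add_lt_top.2 ⟨?_, ?_⟩)
  · refine (lintegral_mono fun z => ENNReal.ofReal_le_ofReal
      (?_ : _ ≤ ‖x - y‖ ^ 2)).trans_lt ?_
    · simpa using bound (x + z) (y + z)
    · simpa using ENNReal.mul_lt_top (by simp) (measure_lt_top _ _)
  · refine (lintegral_mono fun z => ENNReal.ofReal_le_ofReal
      (?_ : _ ≤ ‖-x - -y‖ ^ 2)).trans_lt ?_
    · simpa using bound (-x + z) (-y + z)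
    · simpa using ENNReal.mul_lt_top (by simp) (measure_lt_top _ _)

instance isProbabilityMeasure_symTranslate (γ : Measure E) [IsProbabilityMeasure γ] (x : E) :
    IsProbabilityMeasure (symTranslate γ x) := by
  constructor
  rw [symTranslate, Measure.smul_apply, Measure.add_apply,
    Measure.map_apply (by fun_prop) .univ, Measure.map_apply (by fun_prop) .univ]
  simp [one_add_one_eq_two, ENNReal.inv_mul_cancel]

lemma sq_le_transportCost_of_norm_le {γ : Measure E} [IsProbabilityMeasure γ]
    (hγ : ∫⁻ z, ENNReal.ofReal ‖z‖ ∂γ < ⊤) {r : ℝ} (hr : 0 < r) {x y : E}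
    (hy : r ≤ ‖y‖) (hle : ‖y‖ ≤ ‖x‖) (hinner : 0 ≤ inner ℝ x y) :
    ENNReal.ofReal ((γ.real (Metric.closedBall 0 (r / 8)) / 8 * ‖x - y‖) ^ 2) ≤
      transportCost coneCost (symTranslate γ x) (symTranslate γ y) := by
  rcases eq_or_ne x y with rfl | hxy
  · simp
  obtain ⟨w, hw, hyw, hxyw⟩ := exists_separating_direction hxy
    (norm_pos_iff.1 (hr.trans_le hy)) hle hinner
  refine le_iInf₂ fun π hπ => ?_
  have : IsProbabilityMeasure π := by
    constructor
    rw [← Set.preimage_univ (f := Prod.fst), ← Measure.map_apply measurable_fst .univ, hπ.1]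
    exact measure_univ
  refine sq_le_lintegral_sq measurable_coneCost (by positivity) ?_
  have hκ : 0 ≤ γ.real (Metric.closedBall 0 (r / 8)) := measureReal_nonneg
  set κ := γ.real (Metric.closedBall 0 (r / 8))
  have hsub : inner ℝ (x - y) w = inner ℝ x w - inner ℝ y w := inner_sub_left _ _ _
  have lower := add_le_lintegral_max (γ := γ) (ρ := r / 8) hw (a := inner ℝ x w)
    (b := inner ℝ y w) (by linarith [norm_nonneg (x - y)]) (by linarith) (by linarith)
  rw [← lintegral_abs_inner_symTranslate, ← lintegral_abs_inner_symTranslate] at lower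
  have upper : ∫⁻ u, ENNReal.ofReal |inner ℝ u w| ∂(symTranslate γ x) ≤
      ∫⁻ u, ENNReal.ofReal |inner ℝ u w| ∂(symTranslate γ y) +
        ENNReal.ofReal 2 * ∫⁻ p, ENNReal.ofReal (coneCost p.1 p.2) ∂π := by
    have hm := measurable_coneCost
    rw [← hπ.1, ← hπ.2, lintegral_map (by fun_prop) measurable_fst,
      lintegral_map (by fun_prop) measurable_snd, ← lintegral_const_mul _ (by fun_prop),
      ← lintegral_add_left (by fun_prop)]
    refine lintegral_mono fun p => ?_
    have hc := coneCost_nonneg p.1 p.2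
    rw [← ENNReal.ofReal_mul two_pos.le, ← ENNReal.ofReal_add (abs_nonneg _) (by positivity)]
    refine ENNReal.ofReal_le_ofReal ((abs_inner_le_add_coneCost p.1 p.2 w).trans ?_)
    gcongr
  have fin : ∫⁻ u, ENNReal.ofReal |inner ℝ u w| ∂(symTranslate γ y) ≠ ⊤ := by
    rw [lintegral_abs_inner_symTranslate]
    refine ne_of_lt (lt_of_le_of_lt (lintegral_mono fun z => ?_)
      (?_ : ∫⁻ z, (ENNReal.ofReal |inner ℝ y w| + ENNReal.ofReal 2 * ENNReal.ofReal ‖z‖) ∂γ < ⊤))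
    · rw [← ENNReal.ofReal_mul two_pos.le, ← ENNReal.ofReal_add (abs_nonneg _) (by positivity)]
      refine ENNReal.ofReal_le_ofReal ((max_le_add_of_nonneg (abs_nonneg _) (abs_nonneg _)).trans ?_)
      have := abs_real_inner_le_norm z w
      nlinarith [norm_nonneg z]
    · rw [lintegral_add_left measurable_const, lintegral_const_mul _ (by fun_prop)]
      exact ENNReal.add_lt_top.2 ⟨by simp, ENNReal.mul_lt_top (by simp) hγ⟩
  have key := (ENNReal.add_le_add_iff_left fin).1 (lower.trans upper)
  rw [← ENNReal.mul_le_mul_iff_right (a := ENNReal.ofReal 2) (by simp) (by simp),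
    ← ENNReal.ofReal_mul two_pos.le]
  refine le_trans (ENNReal.ofReal_le_ofReal ?_) key
  rw [← hsub]
  nlinarith

theorem exists_mul_min_le_W2_symTranslate {γ : Measure E} [IsProbabilityMeasure γ]
    (hγ : ∫⁻ z, ENNReal.ofReal ‖z‖ ∂γ < ⊤)
    (hpos : ∀ ρ > 0, 0 < γ (Metric.closedBall 0 ρ)) {r : ℝ} (hr : 0 < r) :
    ∃ C > (0 : ℝ), ∀ x y : E, r ≤ ‖x‖ → r ≤ ‖y‖ →
      C * min ‖x - y‖ ‖x + y‖ ≤ W2 coneCost (symTranslate γ x) (symTranslate γ y) := by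
  have hκ : 0 < γ.real (Metric.closedBall 0 (r / 8)) :=
    ENNReal.toReal_pos (hpos _ (by positivity)).ne' (measure_ne_top _ _)
  refine ⟨γ.real (Metric.closedBall 0 (r / 8)) / 8, by positivity, fun x y hx hy => ?_⟩
  have acute : ∀ x y : E, r ≤ ‖x‖ → r ≤ ‖y‖ → 0 ≤ inner ℝ x y →
      ENNReal.ofReal ((γ.real (Metric.closedBall 0 (r / 8)) / 8 * ‖x - y‖) ^ 2) ≤
        transportCost coneCost (symTranslate γ x) (symTranslate γ y) := by
    intro x y hx hy hi
    rcases le_total ‖y‖ ‖x‖ with h | h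
    · exact sq_le_transportCost_of_norm_le hγ hr hy h hi
    · rw [transportCost_coneCost_comm, norm_sub_rev]
      exact sq_le_transportCost_of_norm_le hγ hr hx h (by rwa [real_inner_comm])
  refine Real.le_sqrt_of_sq_le ((ENNReal.ofReal_le_iff_le_toReal
    (transportCost_symTranslate_lt_top γ x y).ne).1 ?_)
  rcases le_total 0 (inner ℝ x y) with hi | hi
  · refine le_trans (ENNReal.ofReal_le_ofReal ?_) (acute x y hx hy hi)
    gcongr
    exact min_le_left _ _
  · have := acute x (-y) hx (by rwa [norm_neg]) (by rw [inner_neg_right]; linarith)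
    rw [symTranslate_neg, sub_neg_eq_add] at this
    refine le_trans (ENNReal.ofReal_le_ofReal ?_) this
    gcongr
    exact min_le_right _ _

lemma gauss2_eq_map (t : ℝ) (x : E) : gauss2 t x = (gauss2 t 0).map (x + ·) := by
  refine Measure.ext fun s hs => ?_
  rw [Measure.map_apply (by fun_prop) hs, gauss2, gauss2, withDensity_apply _ hs,
    withDensity_apply _ (measurableSet_preimage (by fun_prop) hs),
    ← (measurePreserving_add_left volume x).setLIntegral_comp_preimage_emb
      (measurableEmbedding_addLeft x)]
  simp

lemma integrable_exp_neg_mul_norm_sq {b : ℝ} (hb : 0 < b) :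
    Integrable fun v : E => Real.exp (-b * ‖v‖ ^ 2) := by
  by_contra h
  have h1 := GaussianFourier.integral_rexp_neg_mul_sq_norm (V := E) hb
  rw [integral_undef h] at h1
  have : 0 < (Real.pi / b) ^ ((Module.finrank ℝ E : ℝ) / 2) := by positivity
  linarith

lemma isProbabilityMeasure_gauss2 {t : ℝ} (ht : 0 < t) : IsProbabilityMeasure (gauss2 t 0) := by
  constructor
  have e : ∀ y : E, (4 * Real.pi * t)⁻¹ * Real.exp (-‖y - 0‖ ^ 2 / (4 * t)) =
      (4 * Real.pi * t)⁻¹ * Real.exp (-(4 * t)⁻¹ * ‖y‖ ^ 2) := fun y => by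
    rw [sub_zero]; congr 2; field_simp
  have hb : 0 < (4 * t)⁻¹ := by positivity
  rw [gauss2, withDensity_apply _ .univ, Measure.restrict_univ]
  simp_rw [e]
  rw [← ofReal_integral_eq_lintegral_ofReal ((integrable_exp_neg_mul_norm_sq hb).const_mul _)
    (.of_forall fun y => by positivity), integral_const_mul,
    GaussianFourier.integral_rexp_neg_mul_sq_norm hb]
  simp only [finrank_euclideanSpace, Fintype.card_fin, Nat.cast_ofNat]
  rw [div_self two_ne_zero, Real.rpow_one, ENNReal.ofReal_eq_one]
  have := Real.pi_pos
  field_simp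

lemma lintegral_norm_gauss2_lt_top {t : ℝ} (ht : 0 < t) :
    ∫⁻ z, ENNReal.ofReal ‖z‖ ∂(gauss2 t 0) < ⊤ := by
  have hb : 0 < (8 * t)⁻¹ := by positivity
  rw [gauss2, lintegral_withDensity_eq_lintegral_mul _ (by fun_prop) (by fun_prop)]
  have hint := ((integrable_exp_neg_mul_norm_sq hb).const_mul
    ((4 * Real.pi * t)⁻¹ * (1 + 8 * t))).lintegral_lt_top
  refine (lintegral_mono fun z => ?_).trans_lt hint
  have hπ := Real.pi_pos
  simp only [Pi.mul_apply, sub_zero]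
  rw [← ENNReal.ofReal_mul (by positivity)]
  refine ENNReal.ofReal_le_ofReal ?_
  have e : Real.exp (-‖z‖ ^ 2 / (4 * t)) =
      Real.exp (-(8 * t)⁻¹ * ‖z‖ ^ 2) * Real.exp (-(8 * t)⁻¹ * ‖z‖ ^ 2) := by
    rw [← Real.exp_add]; congr 1; field_simp; ring
  have h1 : ‖z‖ * Real.exp (-(8 * t)⁻¹ * ‖z‖ ^ 2) ≤ 1 + 8 * t := by
    have h2 := Real.add_one_le_exp ((8 * t)⁻¹ * ‖z‖ ^ 2)
    rw [neg_mul, Real.exp_neg, ← div_eq_mul_inv, div_le_iff₀ (Real.exp_pos _)]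
    refine le_trans ?_ (mul_le_mul_of_nonneg_left h2 (by positivity))
    have h3 : (1 + 8 * t) * ((8 * t)⁻¹ * ‖z‖ ^ 2 + 1) =
        (8 * t)⁻¹ * ‖z‖ ^ 2 + ‖z‖ ^ 2 + 1 + 8 * t := by field_simp; ring
    have h4 : 0 ≤ (8 * t)⁻¹ * ‖z‖ ^ 2 := by positivity
    nlinarith [sq_nonneg (‖z‖ - 1)]
  rw [e]
  calc _ = (4 * Real.pi * t)⁻¹ * (‖z‖ * Real.exp (-(8 * t)⁻¹ * ‖z‖ ^ 2)) *
        Real.exp (-(8 * t)⁻¹ * ‖z‖ ^ 2) := by ring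
    _ ≤ _ := by gcongr

lemma gauss2_closedBall_pos {t : ℝ} (ht : 0 < t) {ρ : ℝ} (hρ : 0 < ρ) :
    0 < gauss2 t 0 (Metric.closedBall 0 ρ) := by
  have hπ := Real.pi_pos
  refine pos_iff_ne_zero.2 fun h => ?_
  rw [gauss2, withDensity_apply_eq_zero (by fun_prop)] at h
  have : {y : E | ENNReal.ofReal ((4 * Real.pi * t)⁻¹ *
      Real.exp (-‖y - 0‖ ^ 2 / (4 * t))) ≠ 0} = Set.univ :=
    Set.eq_univ_of_forall fun y => (ENNReal.ofReal_pos.2 (by positivity)).ne'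
  rw [this, Set.univ_inter] at h
  exact (Metric.measure_closedBall_pos volume (0 : E) hρ).ne' h

end SymmetrizedTranslate

/-- away from the apex, the heat kernel embedding of the cone `C(π)` is
bi-Lipschitz: a lower bound of the cone Wasserstein distance between heat kernel lifts
in terms of the cone distance. -/
theorem stmt9 :
    ∀ t : ℝ, 0 ≤ t → ∀ r > (0:ℝ), ∃ C > (0:ℝ),
      ∀ x y : EuclideanSpace ℝ (Fin 2), r ≤ ‖x‖ → r ≤ ‖y‖ →
        C * min ‖x - y‖ ‖x + y‖ ≤ W2 coneCost (symGauss t x) (symGauss t y) := by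
  intro t ht r hr
  rcases ht.eq_or_lt with rfl | ht
  · have h : ∀ x, symGauss 0 x = symTranslate (Measure.dirac 0) x := fun x => by
      simp [symGauss, symTranslate, Measure.map_dirac' (measurable_const_add _)]
    simp_rw [h]
    exact exists_mul_min_le_W2_symTranslate (by simp) (fun ρ hρ => by simp [hρ.le]) hr
  · have h : ∀ x, symGauss t x = symTranslate (gauss2 t 0) x := fun x => by
      rw [symGauss, if_neg ht.ne', symTranslate, gauss2_eq_map, gauss2_eq_map t (-x)]
    have := isProbabilityMeasure_gauss2 ht
    simp_rw [h]
    exact exists_mul_min_le_W2_symTranslate (lintegral_norm_gauss2_lt_top ht)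
      (fun ρ hρ => gauss2_closedBall_pos ht hρ) hr
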